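/- Let σ = (σ_n)_{n≥0} be a directive sequence of non-erasing morphisms σ_n: 𝒜_{n+1} → 𝒜_n⁺ such that liminf_{n→∞} |𝒜_n| < ∞ and sup_{n≥0} |{ℒ_x : x ∈ X^(n)_σ}| < ∞. Then σ is eventually recognizable for aperiodic points: there exists n₀ such that for every n ≥ n₀, every aperiodic point y ∈ 𝒜_n^ℤ has at most one centered σ_n-representation (k,x) with x ∈ X^(n+1)_σ. -/

import Mathlib

open scoped BigOperators

namespace Recog

variable {A B C : Type*}

/-- A morphism assigning a word to each letter is non-erasing if every image is nonempty. -/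
def NonErasing (σ : A → List B) : Prop := ∀ a, σ a ≠ []

/-- Apply a morphism letterwise to a finite word, concatenating the images. -/
def wordApply (σ : A → List B) : List A → List B
  | [] => []
  | a :: w => σ a ++ wordApply σ w

/-- Composition of morphisms `τ ∘ σ`. -/
def comp (τ : B → List C) (σ : A → List B) : A → List C := fun a => wordApply τ (σ a)

/-- The `ℓ`-th cutting point of the representation `(0, x)`:
`|σ(x_[0,ℓ))|` for `ℓ ≥ 0` and `-|σ(x_[ℓ,0))|` for `ℓ < 0`. -/
def cut (σ : A → List B) (x : ℤ → A) (ℓ : ℤ) : ℤ :=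
  if 0 ≤ ℓ then ∑ i ∈ Finset.range ℓ.toNat, ((σ (x i)).length : ℤ)
  else -∑ i ∈ Finset.range (-ℓ).toNat, ((σ (x (-(i : ℤ) - 1))).length : ℤ)

/-- `y` is the bi-infinite image `σ(x)`, where `σ(x₀)` starts at position `0`. -/
def IsSubstPt (σ : A → List B) (x : ℤ → A) (y : ℤ → B) : Prop :=
  ∀ (ℓ : ℤ) (j : ℕ) (hj : j < (σ (x ℓ)).length),
    y (cut σ x ℓ + j) = (σ (x ℓ)).get ⟨j, hj⟩

/-- `(k, x)` is a `σ`-representation of `y`, i.e. `y = T^k σ(x)`. -/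
def IsRep (σ : A → List B) (y : ℤ → B) (k : ℤ) (x : ℤ → A) : Prop :=
  IsSubstPt σ x fun n => y (n - k)

/-- `(k, x)` is a centered `σ`-representation of `y`: `y = T^k σ(x)` with `0 ≤ k < |σ(x₀)|`. -/
def IsCenteredRep (σ : A → List B) (y : ℤ → B) (k : ℤ) (x : ℤ → A) : Prop :=
  IsRep σ y k x ∧ 0 ≤ k ∧ k < ((σ (x 0)).length : ℤ)

/-- `y` is aperiodic: `T^p y ≠ y` for all `p ≥ 1`. -/
def Aperiodic (y : ℤ → B) : Prop := ∀ p : ℕ, 1 ≤ p → (fun n => y (n + p)) ≠ y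

/-- `y` is periodic: `T^p y = y` for some `p ≥ 1`. -/
def Periodic (y : ℤ → B) : Prop := ∃ p : ℕ, 1 ≤ p ∧ (fun n => y (n + p)) = y

/-- The set of `σ`-cutting points of the representation `(k, x)`. -/
def cutSet (σ : A → List B) (x : ℤ → A) (k : ℤ) : Set ℤ :=
  {m : ℤ | ∃ ℓ : ℤ, m = cut σ x ℓ - k}

/-- `σ` is recognizable in `X`: every `y` has at most one centered `σ`-representation in `X`. -/
def RecIn (σ : A → List B) (X : Set (ℤ → A)) : Prop :=
  ∀ (y : ℤ → B) (k k' : ℤ) (x x' : ℤ → A), x ∈ X → x' ∈ X →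
    IsCenteredRep σ y k x → IsCenteredRep σ y k' x' → k = k' ∧ x = x'

/-- `σ` is recognizable in `X` for aperiodic points. -/
def RecInAp (σ : A → List B) (X : Set (ℤ → A)) : Prop :=
  ∀ y : ℤ → B, Aperiodic y → ∀ (k k' : ℤ) (x x' : ℤ → A), x ∈ X → x' ∈ X →
    IsCenteredRep σ y k x → IsCenteredRep σ y k' x' → k = k' ∧ x = x'

/-- `σ` is left permutative: the first letters of `σ a` and `σ b` differ for distinct `a, b`. -/
def LeftPermutative (σ : A → List B) : Prop :=
  ∀ a b : A, a ≠ b → (σ a).head? ≠ (σ b).head?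

/-- `σ` is right permutative: the last letters of `σ a` and `σ b` differ for distinct `a, b`. -/
def RightPermutative (σ : A → List B) : Prop :=
  ∀ a b : A, a ≠ b → (σ a).getLast? ≠ (σ b).getLast?

/-- `σ` and `σ'` are rotationally conjugate. -/
def RotConj (σ σ' : A → List B) : Prop :=
  ∃ w : List B, (∀ a, σ a ++ w = w ++ σ' a) ∨ (∀ a, w ++ σ a = σ' a ++ w)

/-- The incidence matrix of `σ`, over `ℚ`: entry `(b, a)` counts occurrences of `b` in `σ a`. -/
noncomputable def incidence (σ : A → List B) [DecidableEq B] : Matrix B A ℚ :=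
  Matrix.of fun b a => ((σ a).count b : ℚ)

/-- The finite subword `x_[i, i+m)` of a bi-infinite sequence. -/
def factor (x : ℤ → A) (i : ℤ) (m : ℕ) : List A := (List.range m).map fun j => x (i + j)

/-- The language of a bi-infinite sequence: the set of its finite subwords. -/
def lang (x : ℤ → A) : Set (List A) := {w | ∃ (i : ℤ) (m : ℕ), w = factor x i m}

/-- `σ` is injective on bi-infinite sequences. -/
def InjZ (σ : A → List B) : Prop :=
  ∀ (x x' : ℤ → A) (y : ℤ → B), IsSubstPt σ x y → IsSubstPt σ x' y → x = x'

/-- Cutting points for one-sided sequences. -/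
def cutN (σ : A → List B) (x : ℕ → A) (ℓ : ℕ) : ℕ :=
  ∑ i ∈ Finset.range ℓ, (σ (x i)).length

/-- `y` is the one-sided image `σ(x)` for `x : ℕ → A`. -/
def IsSubstPtN (σ : A → List B) (x : ℕ → A) (y : ℕ → B) : Prop :=
  ∀ (ℓ j : ℕ) (hj : j < (σ (x ℓ)).length),
    y (cutN σ x ℓ + j) = (σ (x ℓ)).get ⟨j, hj⟩

/-- `σ` is injective on one-sided (right-infinite) sequences. -/
def InjN (σ : A → List B) : Prop :=
  ∀ (x x' : ℕ → A) (y : ℕ → B), IsSubstPtN σ x y → IsSubstPtN σ x' y → x = x'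

/-- The total length `⦀σ⦀ = Σ_a |σ a|`. -/
def totalLen (σ : A → List B) [Fintype A] : ℕ := ∑ a, (σ a).length

/-- `X` is invariant under the two-sided shift. -/
def ShiftInvariant (X : Set (ℤ → A)) : Prop :=
  ∀ x ∈ X, (fun n => x (n + 1)) ∈ X ∧ (fun n => x (n - 1)) ∈ X

/-- The iterate `σ^n` of a substitution, applied to a letter. -/
def iter (σ : A → List A) : ℕ → A → List A
  | 0, a => [a]
  | n + 1, a => wordApply (iter σ n) (σ a)

/-- The language `ℒ_σ` of a substitution: subwords of the `σ^n(a)`. -/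
def subLang (σ : A → List A) : Set (List A) := {w | ∃ (n : ℕ) (a : A), w <:+: iter σ n a}

/-- The substitutive shift `X_σ`. -/
def subX (σ : A → List A) : Set (ℤ → A) := {x | ∀ w ∈ lang x, w ∈ subLang σ}

/-- `σ` is recognizable in the sense of Mossé for `x`. -/
def MosseRec (σ : A → List B) (x : ℤ → A) : Prop :=
  ∃ ℓ : ℕ, ∀ y : ℤ → B, IsSubstPt σ x y →
    ∀ m ∈ cutSet σ x 0, ∀ m' : ℤ,
      factor y (m - ℓ) (2 * ℓ) = factor y (m' - ℓ) (2 * ℓ) → m' ∈ cutSet σ x 0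

section Sadic

variable {𝒜 : ℕ → Type*}

/-- `block σ N = σ_[0,N)`, mapping a letter of `𝒜 N` to a word over `𝒜 0`. -/
def block (σ : ∀ n, 𝒜 (n + 1) → List (𝒜 n)) : ∀ N, 𝒜 N → List (𝒜 0)
  | 0, a => [a]
  | N + 1, a => wordApply (block σ N) (σ N a)

/-- `blockFrom σ n k = σ_[n,n+k)`, mapping a letter of `𝒜 (n+k)` to a word over `𝒜 n`. -/
def blockFrom (σ : ∀ n, 𝒜 (n + 1) → List (𝒜 n)) (n k : ℕ) : 𝒜 (n + k) → List (𝒜 n) :=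
  block (𝒜 := fun m => 𝒜 (n + m)) (fun m => σ (n + m)) k

/-- The language `ℒ^(n)_σ` of a directive sequence. -/
def sadicLang (σ : ∀ n, 𝒜 (n + 1) → List (𝒜 n)) (n : ℕ) : Set (List (𝒜 n)) :=
  {w | ∃ (k : ℕ) (a : 𝒜 (n + k)), 1 ≤ k ∧ w <:+: blockFrom σ n k a}

/-- The shift `X^(n)_σ` of a directive sequence. -/
def sadicX (σ : ∀ n, 𝒜 (n + 1) → List (𝒜 n)) (n : ℕ) : Set (ℤ → 𝒜 n) :=
  {x | ∀ w ∈ lang x, w ∈ sadicLang σ n}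

/-- A directive sequence is everywhere growing if `min_a |σ_[0,n)(a)| → ∞`. -/
def EverywhereGrowing (σ : ∀ n, 𝒜 (n + 1) → List (𝒜 n)) : Prop :=
  ∀ m : ℕ, ∃ N : ℕ, ∀ n ≥ N, ∀ a : 𝒜 n, m ≤ (block σ n a).length

end Sadic

end Recog

namespace Recog

lemma wa_append {A B : Type*} (σ : A → List B) (u v : List A) :
    wordApply σ (u ++ v) = wordApply σ u ++ wordApply σ v := by
  induction u with
  | nil => simp [wordApply]
  | cons a u ih => simp [wordApply, ih]

lemma wa_comp {A B C : Type*} (τ : B → List C) (σ : A → List B) (u : List A) :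
    wordApply (comp τ σ) u = wordApply τ (wordApply σ u) := by
  induction u with
  | nil => simp [wordApply]
  | cons a u ih => simp [wordApply, ih, wa_append, comp]

lemma comp_assoc' {A B C D : Type*} (α : C → List D) (τ : B → List C) (σ : A → List B) :
    comp α (comp τ σ) = comp (comp α τ) σ := by
  funext a
  simp [comp, ← wa_comp]

lemma wa_map {A B C : Type*} (τ : B → List C) (f : A → B) (u : List A) :
    wordApply τ (u.map f) = wordApply (fun a => τ (f a)) u := by
  induction u with
  | nil => simp [wordApply]
  | cons a u ih => simp [wordApply, ih]

lemma wa_single {A B : Type*} (f : A → B) (u : List A) :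
    wordApply (fun a => [f a]) u = u.map f := by
  induction u with
  | nil => simp [wordApply]
  | cons a u ih => simp [wordApply, ih]

lemma wa_len {A B : Type*} (σ : A → List B) (h : NonErasing σ) (u : List A) :
    u.length ≤ (wordApply σ u).length := by
  induction u with
  | nil => simp
  | cons a u ih =>
    have := List.length_pos_iff.2 (h a)
    simp only [wordApply, List.length_append, List.length_cons]; omega

lemma comp_ne {A B C : Type*} {τ : B → List C} {σ : A → List B} (h : NonErasing τ)
    (h' : NonErasing σ) : NonErasing (comp τ σ) := by
  intro a
  have h1 := wa_len τ h (σ a)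
  have h2 := List.length_pos_iff.2 (h' a)
  apply List.length_pos_iff.1
  simp only [comp]; omega

lemma ne_right {A B C : Type*} {τ : B → List C} {σ : A → List B} (h : NonErasing (comp τ σ)) :
    NonErasing σ := by
  intro a ha
  exact h a (by simp [comp, ha, wordApply])

lemma wa_rev {A B : Type*} (σ : A → List B) (u : List A) :
    (wordApply σ u).reverse = wordApply (fun a => (σ a).reverse) u.reverse := by
  induction u with
  | nil => simp [wordApply]
  | cons a u ih => simp [wordApply, ih, wa_append]

/-- one-sided defect lemma -/
lemma defect {A B : Type*} [Fintype A] (n : ℕ) : ∀ (σ : A → List B) (a b : A) (s t : List A),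
    NonErasing σ → totalLen σ ≤ n → a ≠ b → totalLen σ ≤ s.length → totalLen σ ≤ t.length →
    (wordApply σ (a :: s) <+: wordApply σ (b :: t) ∨
      wordApply σ (b :: t) <+: wordApply σ (a :: s)) →
    ∃ (ρ : A → List A) (τ : A → List B) (e f : A), e ≠ f ∧ NonErasing τ ∧ σ = comp τ ρ ∧
      τ e = τ f ∧ ∀ g, ∃ l, ρ g = l ++ [g] := by
  classical
  induction n with
  | zero =>
    intro σ a b s t h0 hn
    exfalso
    have h1 : (σ a).length ≤ totalLen σ := by
      unfold totalLen
      exact Finset.single_le_sum (f := fun a => (σ a).length) (fun _ _ => Nat.zero_le _)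
        (Finset.mem_univ a)
    have := List.length_pos_iff.2 (h0 a)
    omega
  | succ n ih =>
    have key : ∀ (σ : A → List B) (a b : A) (s t : List A),
      NonErasing σ → totalLen σ ≤ n + 1 → a ≠ b → totalLen σ ≤ s.length →
      totalLen σ ≤ t.length →
      (wordApply σ (a :: s) <+: wordApply σ (b :: t) ∨
        wordApply σ (b :: t) <+: wordApply σ (a :: s)) → σ a <+: σ b →
      ∃ (ρ : A → List A) (τ : A → List B) (e f : A), e ≠ f ∧ NonErasing τ ∧ σ = comp τ ρ ∧
        τ e = τ f ∧ ∀ g, ∃ l, ρ g = l ++ [g] := by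
      intro σ a b s t h0 hn hab hs ht hc hp
      obtain ⟨r, hr⟩ := hp
      by_cases hr0 : r = []
      · refine ⟨fun g => [g], σ, a, b, hab, h0, ?_, ?_, fun g => ⟨[], rfl⟩⟩
        · funext g; simp [comp, wordApply]
        · simpa [hr0] using hr
      set σ1 : A → List B := Function.update σ b r with hσ1
      set ρ1 : A → List A := fun g => if g = b then [a, b] else [g] with hρ1
      have e1 : σ1 b = r := by simp [hσ1]
      have e2 : ∀ g, g ≠ b → σ1 g = σ g := fun g hg => by simp [hσ1, hg]
      have hcomp : σ = comp σ1 ρ1 := by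
        funext g
        by_cases hg : g = b
        · subst hg; simp [comp, hρ1, wordApply, e1, e2 a hab, hr]
        · simp [comp, hρ1, wordApply, hg, e2 g hg]
      have hne1 : NonErasing σ1 := by
        intro g
        by_cases hg : g = b
        · subst hg; rw [e1]; exact hr0
        · rw [e2 g hg]; exact h0 g
      have hneρ : NonErasing ρ1 := by
        intro g; simp only [hρ1]; split_ifs <;> simp
      have hlt : totalLen σ1 < totalLen σ := by
        unfold totalLen
        apply Finset.sum_lt_sum
        · intro g _
          by_cases hg : g = b
          · subst hg; rw [e1, ← hr]; simp
          · rw [e2 g hg]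
        · refine ⟨b, Finset.mem_univ b, ?_⟩
          have := List.length_pos_iff.2 (h0 a)
          rw [e1, ← hr, List.length_append]; omega
      obtain ⟨g, s', rfl⟩ : ∃ g s', s = g :: s' := by
        cases s with
        | nil => simp at hs; omega
        | cons g s' => exact ⟨g, s', rfl⟩
      obtain ⟨h, S', hS, hhb, hlen⟩ : ∃ h S', wordApply ρ1 (g :: s') = h :: S' ∧ h ≠ b ∧
          s'.length ≤ S'.length := by
        have hl := wa_len ρ1 hneρ s'
        by_cases hg : g = b
        · refine ⟨a, b :: wordApply ρ1 s', by simp [wordApply, hρ1, hg], hab, ?_⟩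
          simp; omega
        · exact ⟨g, wordApply ρ1 s', by simp [wordApply, hρ1, hg], hg, hl⟩
      have hlt' := wa_len ρ1 hneρ t
      simp only [List.length_cons] at hs
      have hw1 : wordApply σ (a :: (g :: s')) = σ a ++ wordApply σ1 (h :: S') := by
        rw [← hS, ← wa_comp, ← hcomp]; rfl
      have hw2 : wordApply σ (b :: t) = σ a ++ wordApply σ1 (b :: wordApply ρ1 t) := by
        simp only [wordApply]
        rw [← wa_comp, ← hcomp, e1, ← hr, List.append_assoc]
      rw [hw1, hw2, List.prefix_append_right_inj, List.prefix_append_right_inj] at hc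
      obtain ⟨ρ, τ, e, f, hef, hτ, hστ, hτe, hl⟩ := ih σ1 h b S' (wordApply ρ1 t) hne1 (by omega)
        hhb (by omega) (by omega) hc
      refine ⟨comp ρ ρ1, τ, e, f, hef, hτ, ?_, hτe, ?_⟩
      · rw [comp_assoc', ← hστ, ← hcomp]
      · intro k
        by_cases hk : k = b
        · obtain ⟨l, hl⟩ := hl b
          refine ⟨ρ a ++ l, ?_⟩
          simp [comp, hρ1, hk, wordApply, hl]
        · obtain ⟨l, hl⟩ := hl k
          refine ⟨l, ?_⟩
          simp [comp, hρ1, hk, wordApply, hl]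
    intro σ a b s t h0 hn hab hs ht hc
    have : σ a <+: σ b ∨ σ b <+: σ a := by
      have p1 : σ a <+: wordApply σ (a :: s) := by simp [wordApply]
      have p2 : σ b <+: wordApply σ (b :: t) := by simp [wordApply]
      rcases hc with hc | hc
      · exact List.prefix_or_prefix_of_prefix (p1.trans hc) p2
      · exact List.prefix_or_prefix_of_prefix p1 (p2.trans hc)
    rcases this with h | h
    · exact key σ a b s t h0 hn hab hs ht hc h
    · exact key σ b a t s h0 hn hab.symm ht hs hc.symm h

/-! factors -/

lemma factor_def {A : Type*} (x : ℤ → A) (i : ℤ) (m : ℕ) :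
    factor x i m = (List.range m).map fun j : ℕ => x (i + (j : ℤ)) := by
  unfold factor
  apply List.ext_getElem?
  intro k
  simp [← List.map_eq_flatMap]
  rfl

lemma factor_length {A : Type*} (x : ℤ → A) (i : ℤ) (m : ℕ) : (factor x i m).length = m := by
  simp [factor]

lemma factor_add {A : Type*} (x : ℤ → A) (i : ℤ) (m n : ℕ) :
    factor x i (m + n) = factor x i m ++ factor x (i + m) n := by
  simp only [factor_def, List.range_add, List.map_append, List.map_map]
  congr 1
  apply List.map_congr_left
  intro j _
  simp [add_assoc]

lemma factor_one {A : Type*} (x : ℤ → A) (i : ℤ) : factor x i 1 = [x i] := by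
  simp [factor]

lemma factor_cons {A : Type*} (x : ℤ → A) (i : ℤ) (n : ℕ) :
    factor x i (n + 1) = x i :: factor x (i + 1) n := by
  rw [add_comm, factor_add, factor_one]; simp

lemma factor_congr {A : Type*} {x x' : ℤ → A} {i i' : ℤ} {n : ℕ}
    (h : ∀ j : ℕ, j < n → x (i + j) = x' (i' + j)) : factor x i n = factor x' i' n := by
  rw [factor_def, factor_def]
  apply List.map_congr_left
  intro j hj
  exact h j (List.mem_range.1 hj)

lemma factor_inj {A : Type*} {x x' : ℤ → A} {i i' : ℤ} {n : ℕ}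
    (h : factor x i n = factor x' i' n) (j : ℕ) (hj : j < n) : x (i + j) = x' (i' + j) := by
  have := congrArg (fun l => l[j]?) h
  simpa [factor_def, hj] using this

lemma factor_prefix {A : Type*} (x : ℤ → A) (i : ℤ) {m n : ℕ} (h : m ≤ n) :
    factor x i m <+: factor x i n := by
  obtain ⟨k, rfl⟩ := Nat.exists_eq_add_of_le h
  rw [factor_add]; exact List.prefix_append _ _

lemma factor_comparable {A : Type*} (x : ℤ → A) (i : ℤ) (m n : ℕ) :
    factor x i m <+: factor x i n ∨ factor x i n <+: factor x i m := by
  rcases le_total m n with h | h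
  · exact Or.inl (factor_prefix x i h)
  · exact Or.inr (factor_prefix x i h)

lemma factor_split {A : Type*} {x : ℤ → A} {i : ℤ} {n : ℕ} {u v : List A}
    (h : factor x i n = u ++ v) : u = factor x i u.length ∧ v = factor x (i + u.length) v.length := by
  have hn : n = u.length + v.length := by
    have := congrArg List.length h
    simpa [factor_length] using this
  subst hn
  rw [factor_add] at h
  have := List.append_inj h (by simp [factor_length])
  exact ⟨this.1.symm, this.2.symm⟩

lemma factor_last {A : Type*} {x : ℤ → A} {i : ℤ} {n : ℕ} {l : List A} {g : A}
    (h : factor x i n = l ++ [g]) : x (i + n - 1) = g := by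
  have hn : n = l.length + 1 := by
    have := congrArg List.length h
    simpa [factor_length] using this
  have h2 := (factor_split h).2
  rw [List.length_singleton, factor_one] at h2
  subst hn
  have : x (i + l.length) = g := by simpa using h2.symm
  rw [← this]; congr 1; push_cast; ring

lemma factor_rev {A : Type*} (x : ℤ → A) (i : ℤ) (n : ℕ) :
    (factor x i n).reverse = factor (fun t => x (-1 - t)) (-(i + n)) n := by
  induction n generalizing i with
  | zero => simp [factor]
  | succ n ih =>
    rw [factor_cons, List.reverse_cons, ih, factor_add]
    congr 1
    · apply factor_congr; intro j _; congr 1; push_cast; ring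
    · rw [factor_one]; congr 2; push_cast; ring

/-! representations -/

structure Rep {A B : Type*} (σ : A → List B) (x : ℤ → A) (c : ℤ → ℤ) (y : ℤ → B) : Prop where
  cut : ∀ i, c (i + 1) = c i + (σ (x i)).length
  eq : ∀ i, σ (x i) = factor y (c i) (σ (x i)).length

lemma Rep.word {A B : Type*} {σ : A → List B} {x : ℤ → A} {c : ℤ → ℤ} {y : ℤ → B}
    (h : Rep σ x c y) (i : ℤ) (n : ℕ) :
    c (i + n) = c i + (wordApply σ (factor x i n)).length ∧
    wordApply σ (factor x i n) = factor y (c i) (wordApply σ (factor x i n)).length := by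
  induction n with
  | zero => simp [factor, wordApply]
  | succ n ih =>
    obtain ⟨h1, h2⟩ := ih
    have e : wordApply σ (factor x i (n+1)) = wordApply σ (factor x i n) ++ σ (x (i + n)) := by
      rw [factor_add, wa_append, factor_one]; simp [wordApply]
    have h3 := h.cut (i + n)
    constructor
    · rw [e, List.length_append]; push_cast
      rw [← add_assoc, h3, h1]; ring
    · rw [e, List.length_append, factor_add, ← h2, ← h1, ← h.eq]

lemma Rep.mono {A B : Type*} {σ : A → List B} {x : ℤ → A} {c : ℤ → ℤ} {y : ℤ → B}
    (h : Rep σ x c y) (hσ : NonErasing σ) : StrictMono c := by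
  apply strictMono_int_of_lt_succ
  intro i
  rw [h.cut]
  have := List.length_pos_iff.2 (hσ (x i))
  omega

lemma cover_mono {c : ℤ → ℤ} (h : StrictMono c) (hs : ∀ t, ∃ i, t < c i) (hs' : ∀ t, ∃ i, c i ≤ t)
    (t : ℤ) : ∃ i, c i ≤ t ∧ t < c (i + 1) := by
  obtain ⟨b, hb⟩ := hs t
  obtain ⟨i, hi, hm⟩ := Int.exists_greatest_of_bdd (P := fun i => c i ≤ t)
    ⟨b, fun z hz => (h.lt_iff_lt.1 (lt_of_le_of_lt hz hb)).le⟩ (hs' t)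
  refine ⟨i, hi, ?_⟩
  by_contra hcon
  have := hm (i + 1) (not_lt.1 hcon)
  omega

lemma mono_cover {c : ℤ → ℤ} (h : StrictMono c) (t : ℤ) : ∃ i, c i ≤ t ∧ t < c (i + 1) := by
  have up : ∀ n : ℕ, c 0 + n ≤ c n := by
    intro n
    induction n with
    | zero => simp
    | succ n ih =>
      have : c n < c ((n + 1 : ℕ) : ℤ) := h (by push_cast; omega)
      push_cast at *; omega
  have dn : ∀ n : ℕ, c (-n) ≤ c 0 - n := by
    intro n
    induction n with
    | zero => simp
    | succ n ih =>
      have : c (-((n + 1 : ℕ) : ℤ)) < c (-n) := h (by push_cast; omega)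
      push_cast at *; omega
  apply cover_mono h
  · intro t
    refine ⟨((t - c 0).toNat + 1 : ℕ), ?_⟩
    have := up ((t - c 0).toNat + 1)
    push_cast at *; omega
  · intro t
    refine ⟨-((c 0 - t).toNat : ℕ), ?_⟩
    have := dn ((c 0 - t).toNat)
    omega

lemma cover_unique {c : ℤ → ℤ} (h : StrictMono c) {t i j : ℤ} (hi : c i ≤ t ∧ t < c (i + 1))
    (hj : c j ≤ t ∧ t < c (j + 1)) : i = j := by
  have h1 := h.lt_iff_lt.1 (lt_of_le_of_lt hi.1 hj.2)
  have h2 := h.lt_iff_lt.1 (lt_of_le_of_lt hj.1 hi.2)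
  omega

lemma cuts_unique {c c' : ℤ → ℤ} (f : ℤ → ℤ) (h : ∀ i, c (i + 1) = c i + f i)
    (h' : ∀ i, c' (i + 1) = c' i + f i) (k : ℤ) (h0 : c k = c' k) (i : ℤ) : c i = c' i := by
  have up : ∀ n : ℕ, c (k + n) = c' (k + n) := by
    intro n
    induction n with
    | zero => simpa using h0
    | succ n ih => push_cast; rw [← add_assoc, h, h', ih]
  have dn : ∀ n : ℕ, c (k - n) = c' (k - n) := by
    intro n
    induction n with
    | zero => simpa using h0
    | succ n ih =>
      have h1 := h (k - (n + 1 : ℕ))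
      have h2 := h' (k - (n + 1 : ℕ))
      have e : k - ((n + 1 : ℕ) : ℤ) + 1 = k - n := by push_cast; ring
      rw [e] at h1 h2
      omega
  rcases le_total k i with hk | hk
  · have := up (i - k).toNat
    rw [show k + ((i - k).toNat : ℤ) = i by omega] at this; exact this
  · have := dn (k - i).toNat
    rw [show k - ((k - i).toNat : ℤ) = i by omega] at this; exact this

lemma Rep.unique {A B : Type*} {σ : A → List B} {x : ℤ → A} {c : ℤ → ℤ} {y y' : ℤ → B}
    (hσ : NonErasing σ) (h : Rep σ x c y) (h' : Rep σ x c y') : y = y' := by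
  funext t
  obtain ⟨i, h1, h2⟩ := mono_cover (h.mono hσ) t
  have := factor_inj ((h.eq i).symm.trans (h'.eq i)) (t - c i).toNat (by
    have := h.cut i; omega)
  rw [show c i + ((t - c i).toNat : ℤ) = t by omega] at this
  exact this

lemma Rep.shiftY {A B : Type*} {σ : A → List B} {x : ℤ → A} {c : ℤ → ℤ} {y : ℤ → B}
    (h : Rep σ x c y) (s : ℤ) : Rep σ x (fun i => c i + s) (fun t => y (t - s)) := by
  refine ⟨fun i => by rw [h.cut]; ring, fun i => ?_⟩
  conv_lhs => rw [h.eq i]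
  apply factor_congr; intro j _; congr 1; ring

lemma Rep.shiftX {A B : Type*} {σ : A → List B} {x : ℤ → A} {c : ℤ → ℤ} {y : ℤ → B}
    (h : Rep σ x c y) (s : ℤ) : Rep σ (fun i => x (i + s)) (fun i => c (i + s)) y := by
  refine ⟨fun i => ?_, fun i => h.eq (i + s)⟩
  rw [← h.cut]; congr 1; ring

lemma Rep.rev {A B : Type*} {σ : A → List B} {x : ℤ → A} {c : ℤ → ℤ} {y : ℤ → B}
    (h : Rep σ x c y) : Rep (fun a => (σ a).reverse) (fun i => x (-1 - i)) (fun i => -c (-i))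
      (fun t => y (-1 - t)) := by
  have hc : ∀ i, c (-i) = c (-1 - i) + (σ (x (-1 - i))).length := by
    intro i; rw [← h.cut]; congr 1; ring
  refine ⟨fun i => ?_, fun i => ?_⟩
  · have := hc i
    simp only [List.length_reverse]
    rw [show -(i + 1) = -1 - i by ring]; omega
  · simp only [List.length_reverse]
    conv_lhs => rw [h.eq (-1 - i), factor_rev]
    rw [hc i]

lemma cut_succ' {A B : Type*} (σ : A → List B) (x : ℤ → A) (l : ℤ) :
    Recog.cut σ x (l + 1) = Recog.cut σ x l + (σ (x l)).length := by
  unfold Recog.cut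
  rcases lt_trichotomy l (-1) with h | h | h
  · obtain ⟨n, rfl⟩ : ∃ n : ℕ, l = -(n : ℤ) - 2 := ⟨(-l - 2).toNat, by omega⟩
    rw [if_neg (by omega), if_neg (by omega)]
    rw [show (-(-(n:ℤ) - 2 + 1)).toNat = n + 1 by omega,
      show (-(-(n:ℤ) - 2)).toNat = (n + 1) + 1 by omega, Finset.sum_range_succ _ (n + 1)]
    rw [show (-(((n + 1 : ℕ)) : ℤ) - 1) = -(n : ℤ) - 2 by push_cast; ring]
    ring
  · subst h; simp
  · obtain ⟨n, rfl⟩ : ∃ n : ℕ, l = n := ⟨l.toNat, by omega⟩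
    rw [if_pos (by omega), if_pos (by omega)]
    rw [show ((n:ℤ) + 1).toNat = n + 1 by omega, Finset.sum_range_succ]; simp

lemma exists_rep {A B : Type*} (σ : A → List B) (hσ : NonErasing σ) (x : ℤ → A) (s : ℤ) :
    ∃ c y, Rep σ x c y ∧ c 0 = s := by
  set c : ℤ → ℤ := fun i => Recog.cut σ x i + s with hc
  have hcs : ∀ i, c (i + 1) = c i + (σ (x i)).length := by
    intro i; simp only [hc, cut_succ']; ring
  have hm : StrictMono c := by
    apply strictMono_int_of_lt_succ
    intro i
    rw [hcs]
    have := List.length_pos_iff.2 (hσ (x i))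
    omega
  choose I hI1 hI2 using mono_cover hm
  have hlt : ∀ t, (t - c (I t)).toNat < (σ (x (I t))).length := by
    intro t; have := hI1 t; have := hI2 t; have := hcs (I t); omega
  refine ⟨c, fun t => (σ (x (I t)))[(t - c (I t)).toNat]'(hlt t), ⟨hcs, ?_⟩, ?_⟩
  · intro i
    apply List.ext_getElem
    · simp [factor_length]
    · intro j h1 h2
      have : I (c i + j) = i := cover_unique hm ⟨hI1 _, hI2 _⟩ ⟨by omega, by rw [hcs]; omega⟩
      simp only [factor_def, List.getElem_map, List.getElem_range]
      simp [this]
  · simp [hc, Recog.cut]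

lemma Rep.comp {A B C : Type*} {α : C → List B} {β : A → List C} {x : ℤ → A} {d e : ℤ → ℤ}
    {q : ℤ → C} {y : ℤ → B} (h1 : Rep β x d q) (h2 : Rep α q e y) :
    Rep (Recog.comp α β) x (fun i => e (d i)) y := by
  refine ⟨fun i => ?_, fun i => ?_⟩
  · have := (h2.word (d i) (β (x i)).length).1
    rw [← h1.eq, ← h1.cut] at this
    exact this
  · have := (h2.word (d i) (β (x i)).length).2
    rw [← h1.eq] at this
    exact this

lemma Rep.decomp {A B C : Type*} {α : C → List B} {β : A → List C} (hα : NonErasing α)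
    (hβ : NonErasing β) {x : ℤ → A} {c : ℤ → ℤ} {y : ℤ → B}
    (h : Rep (Recog.comp α β) x c y) :
    ∃ q d e, Rep β x d q ∧ Rep α q e y ∧ ∀ i, e (d i) = c i := by
  obtain ⟨d, q, h1, hd⟩ := exists_rep β hβ x 0
  obtain ⟨e, y', h2, he⟩ := exists_rep α hα q (c 0)
  have h3 := h1.comp h2
  have hc : ∀ i, e (d i) = c i :=
    cuts_unique (fun i => ((Recog.comp α β (x i)).length : ℤ)) h3.cut h.cut 0 (by simp [hd, he])
  have hc' : (fun i => e (d i)) = c := funext hc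
  rw [hc'] at h3
  have := h3.unique (comp_ne hα hβ) h
  subst this
  exact ⟨q, d, e, h1, h2, hc⟩

end Recog

namespace Recog

/-- `σ` factors through an alphabet with `m` letters. -/
def Fac {A B : Type*} (σ : A → List B) (m : ℕ) : Prop :=
  ∃ (β : A → List (Fin m)) (α : Fin m → List B), NonErasing α ∧ σ = comp α β

/-- `σ` is elementary. -/
def Elem {A B : Type*} [Fintype A] (σ : A → List B) : Prop :=
  ∀ m, m < Fintype.card A → ¬ Fac σ m

lemma Fac.of_left {A B C : Type*} {α : C → List B} (β : A → List C) {m : ℕ} (h : Fac α m) :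
    Fac (comp α β) m := by
  obtain ⟨β', α', h1, rfl⟩ := h
  exact ⟨comp β' β, α', h1, (comp_assoc' _ _ _).symm⟩

lemma Fac.of_right {A B C : Type*} {α : C → List B} {β : A → List C} {m : ℕ} (hα : NonErasing α)
    (h : Fac β m) : Fac (comp α β) m := by
  obtain ⟨β', α', h1, rfl⟩ := h
  exact ⟨β', comp α α', comp_ne hα h1, comp_assoc' _ _ _⟩

lemma Fac.of_type {A B C : Type*} [Fintype C] (α : C → List B) (hα : NonErasing α)
    (β : A → List C) : Fac (comp α β) (Fintype.card C) := by
  let E := Fintype.equivFin C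
  refine ⟨fun a => (β a).map E, fun i => α (E.symm i), fun i => hα _, ?_⟩
  funext a
  simp [comp, wa_map]

lemma rev_ne {A B : Type*} {σ : A → List B} (h : NonErasing σ) :
    NonErasing (fun a => (σ a).reverse) := fun a => by simpa using h a

lemma Fac.rev {A B : Type*} {σ : A → List B} {m : ℕ} (h : Fac (fun a => (σ a).reverse) m) :
    Fac σ m := by
  obtain ⟨β, α, h1, h2⟩ := h
  refine ⟨fun a => (β a).reverse, fun a => (α a).reverse, rev_ne h1, ?_⟩
  funext a
  have := congrFun h2 a
  simp only [comp] at this ⊢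
  rw [← wa_rev, ← this, List.reverse_reverse]

lemma Elem.rev {A B : Type*} [Fintype A] {σ : A → List B} (h : Elem σ) :
    Elem (fun a => (σ a).reverse) := fun m hm hf => h m hm hf.rev

/-- merging map -/
noncomputable def merge {A : Type*} (e f : A) (h : e ≠ f) (g : A) : {g : A // g ≠ f} :=
  open Classical in if h' : g = f then ⟨e, h⟩ else ⟨g, h'⟩

lemma merge_inj {A : Type*} {e f : A} {h : e ≠ f} {g g' : A} (hg : g ≠ g')
    (he : merge e f h g = merge e f h g') : (g = e ∧ g' = f) ∨ (g = f ∧ g' = e) := by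
  unfold merge at he
  split_ifs at he with h1 h2 h2
  · exact absurd (h1.trans h2.symm) hg
  · right; exact ⟨h1, (Subtype.mk.inj he).symm⟩
  · left; exact ⟨Subtype.mk.inj he, h2⟩
  · exact absurd (Subtype.mk.inj he) hg

lemma merge_val {A B : Type*} {e f : A} {h : e ≠ f} {τ : A → B} (he : τ e = τ f) (g : A) :
    τ (merge e f h g).1 = τ g := by
  unfold merge
  split_ifs with h1
  · rw [h1, he]
  · rfl

lemma merge_card {A : Type*} [Fintype A] (f : A) [Fintype {g : A // g ≠ f}] :
    Fintype.card {g : A // g ≠ f} = Fintype.card A - 1 := by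
  classical
  rw [Fintype.card_subtype_compl]; simp

lemma Fac.merge {A B : Type*} [Fintype A] {τ : A → List B} (hτ : NonErasing τ) {e f : A}
    (h : e ≠ f) (he : τ e = τ f) : Fac τ (Fintype.card A - 1) := by
  classical
  have := Fac.of_type (fun g : {g : A // g ≠ f} => τ g.1) (fun g => hτ _)
    (fun g => [Recog.merge e f h g])
  rw [merge_card] at this
  convert this using 1
  funext g
  simp [comp, wordApply, merge_val he]

lemma Elem.head {A B : Type*} [Fintype A] {σ : A → List B} (hE : Elem σ) (hσ : NonErasing σ)
    {x x' : ℤ → A} {c c' : ℤ → ℤ} {y : ℤ → B} (h : Rep σ x c y) (h' : Rep σ x' c' y)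
    {i i' : ℤ} (hc : c i = c' i') : x i = x' i' := by
  by_contra hne
  have w1 := (h.word i (totalLen σ + 1)).2
  have w2 := (h'.word i' (totalLen σ + 1)).2
  have hcmp := factor_comparable y (c i) (wordApply σ (factor x i (totalLen σ + 1))).length
    (wordApply σ (factor x' i' (totalLen σ + 1))).length
  rw [← w1, hc, ← w2, factor_cons, factor_cons] at hcmp
  obtain ⟨ρ, τ, e, f, hef, hτ, hστ, he, -⟩ := defect _ σ _ _ _ _ hσ le_rfl hne
    (by rw [factor_length]) (by rw [factor_length]) hcmp
  apply hE (Fintype.card A - 1)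
  · have : 0 < Fintype.card A := Fintype.card_pos_iff.2 ⟨e⟩
    omega
  · rw [hστ]; exact (Fac.merge hτ hef he).of_left ρ

lemma Elem.right {A B : Type*} [Fintype A] {σ : A → List B} (hE : Elem σ) (hσ : NonErasing σ)
    {x x' : ℤ → A} {c c' : ℤ → ℤ} {y : ℤ → B} (h : Rep σ x c y) (h' : Rep σ x' c' y)
    {i i' : ℤ} (hc : c i = c' i') (n : ℕ) :
    x (i + n) = x' (i' + n) ∧ c (i + n) = c' (i' + n) := by
  induction n with
  | zero => simpa using ⟨hE.head hσ h h' hc, hc⟩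
  | succ n ih =>
    have : c (i + (n + 1 : ℕ)) = c' (i' + (n + 1 : ℕ)) := by
      push_cast
      rw [← add_assoc, ← add_assoc, h.cut, h'.cut, ih.1, ih.2]
    exact ⟨hE.head hσ h h' this, this⟩

lemma Elem.both {A B : Type*} [Fintype A] {σ : A → List B} (hE : Elem σ) (hσ : NonErasing σ)
    {x x' : ℤ → A} {c c' : ℤ → ℤ} {y : ℤ → B} (h : Rep σ x c y) (h' : Rep σ x' c' y)
    {i i' : ℤ} (hc : c i = c' i') (k : ℤ) :
    x (i + k) = x' (i' + k) ∧ c (i + k) = c' (i' + k) := by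
  rcases le_or_gt 0 k with hk | hk
  · have := hE.right hσ h h' hc k.toNat
    rwa [show ((k.toNat : ℕ) : ℤ) = k by omega] at this
  · have hr := hE.rev.right (rev_ne hσ) h.rev h'.rev (i := -i) (i' := -i') (by simp [hc])
    constructor
    · have := (hr (-k - 1).toNat).1
      rw [show (((-k - 1).toNat : ℕ) : ℤ) = -k - 1 by omega] at this
      convert this using 2 <;> ring
    · have := (hr (-k).toNat).2
      rw [show (((-k).toNat : ℕ) : ℤ) = -k by omega] at this
      have h2 := neg_injective this
      convert h2 using 2 <;> ring

/-! deterministic argument -/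

lemma periodic_of_det {T : Type*} (S : ℤ → T) (hf : (Set.range S).Finite)
    (hd : ∀ t t', S t = S t' → S (t - 1) = S (t' - 1)) :
    ∃ p : ℕ, 1 ≤ p ∧ ∀ t, S (t + p) = S t := by
  classical
  by_contra! hcon
  choose! s hs using hcon
  set M := hf.toFinset.card with hM
  set T0 : ℤ := ∑ p ∈ Finset.range (M + 1), |s p| with hT
  have hb : ∀ p ∈ Finset.range (M + 1), s p ≤ T0 := by
    intro p hp
    exact (le_abs_self _).trans
      (Finset.single_le_sum (f := fun p => |s p|) (fun _ _ => abs_nonneg _) hp)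
  have main : ∀ i j : ℕ, i < j → j ≤ M → S (T0 + i) = S (T0 + j) → False := by
    intro i j hij hj he
    have down : ∀ n : ℕ, S (T0 + i - n) = S (T0 + j - n) := by
      intro n
      induction n with
      | zero => simpa using he
      | succ n ih =>
        have := hd _ _ ih
        convert this using 2 <;> push_cast <;> ring
    have h1 := hs (j - i) (by omega)
    have h2 := hb (j - i) (by simp; omega)
    apply h1
    have := down (T0 + i - s (j - i)).toNat
    rw [show (((T0 + i - s (j - i)).toNat : ℕ) : ℤ) = T0 + i - s (j - i) by omega] at this
    rw [Nat.cast_sub hij.le]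
    convert this.symm using 2 <;> ring
  obtain ⟨i, hi, j, hj, hij, he⟩ := Finset.exists_ne_map_eq_of_card_lt_of_maps_to
    (s := Finset.range (M + 1)) (t := hf.toFinset) (f := fun i : ℕ => S (T0 + i))
    (by simp [hM]) (by intro i _; simp)
  simp only [Finset.mem_range] at hi hj
  rcases lt_or_gt_of_ne hij with h | h
  · exact main i j h (by omega) he
  · exact main j i h (by omega) he.symm

lemma half_step {A C : Type*} {β : A → List C} (hβ : NonErasing β) (lst : A → C)
    (hinj : Function.Injective lst) (hl : ∀ b, ∃ l, β b = l ++ [lst b])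
    {x : ℤ → A} {d : ℤ → ℤ} {q : ℤ → C} (h : Rep β x d q) (I : ℤ → ℤ)
    (hI : ∀ t, d (I t) ≤ t ∧ t < d (I t + 1)) {t t' : ℤ} (h1 : x (I t) = x (I t'))
    (h2 : t - d (I t) = t' - d (I t')) (h3 : 0 < t - d (I t) ∨ q (t - 1) = q (t' - 1)) :
    x (I (t - 1)) = x (I (t' - 1)) ∧ t - 1 - d (I (t - 1)) = t' - 1 - d (I (t' - 1)) := by
  have hm := h.mono hβ
  by_cases h0 : 0 < t - d (I t)
  · have e : ∀ t, 0 < t - d (I t) → I (t - 1) = I t := by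
      intro t ht
      exact cover_unique hm (hI _) ⟨by omega, by have := (hI t).2; omega⟩
    rw [e t h0, e t' (by omega)]
    exact ⟨h1, by omega⟩
  · have hq := h3.resolve_left h0
    have e : ∀ t, ¬ 0 < t - d (I t) → I (t - 1) = I t - 1 ∧ lst (x (I t - 1)) = q (t - 1) ∧
        t = d (I t - 1) + (β (x (I t - 1))).length := by
      intro t ht
      have ht' : t = d (I t) := by have := (hI t).1; omega
      have hc := h.cut (I t - 1)
      rw [sub_add_cancel] at hc
      have := List.length_pos_iff.2 (hβ (x (I t - 1)))
      refine ⟨cover_unique hm (hI _) ⟨by omega, by rw [sub_add_cancel]; omega⟩, ?_, by omega⟩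
      obtain ⟨l, hl⟩ := hl (x (I t - 1))
      have hf := factor_last ((h.eq (I t - 1)).symm.trans hl)
      rw [← hf, ← hc, ← ht']
    obtain ⟨a1, a2, a3⟩ := e t h0
    obtain ⟨b1, b2, b3⟩ := e t' (by omega)
    have hx : x (I t - 1) = x (I t' - 1) := hinj (by rw [a2, b2, hq])
    rw [a1, b1]
    refine ⟨hx, ?_⟩
    rw [hx] at a3
    omega

lemma half_val {A C : Type*} {β : A → List C}
    {x : ℤ → A} {d : ℤ → ℤ} {q : ℤ → C} (h : Rep β x d q) (I : ℤ → ℤ)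
    (hI : ∀ t, d (I t) ≤ t ∧ t < d (I t + 1)) {t t' : ℤ} (h1 : x (I t) = x (I t'))
    (h2 : t - d (I t) = t' - d (I t')) : q t = q t' := by
  have e1 := h.eq (I t)
  have e2 := h.eq (I t')
  rw [← h1] at e2
  have := factor_inj (e1.symm.trans e2) (t - d (I t)).toNat (by
    have := hI t; have := h.cut (I t); omega)
  have := (hI t).1
  convert ‹q _ = q _› using 2 <;> omega

lemma half_bound {A C : Type*} [Fintype A] {β : A → List C}
    {x : ℤ → A} {d : ℤ → ℤ} {q : ℤ → C} (h : Rep β x d q) (I : ℤ → ℤ)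
    (hI : ∀ t, d (I t) ≤ t ∧ t < d (I t + 1)) (t : ℤ) :
    t - d (I t) ∈ Set.Icc (0 : ℤ) (totalLen β) := by
  have h1 : (β (x (I t))).length ≤ totalLen β := by
    unfold totalLen
    exact Finset.single_le_sum (f := fun a => (β a).length) (fun _ _ => Nat.zero_le _)
      (Finset.mem_univ _)
  have := hI t
  have := h.cut (I t)
  constructor <;> omega

lemma det_periodic {A C : Type*} [Fintype A] {β : A → List C} (hβ : NonErasing β) (lst : A → C)
    (hinj : Function.Injective lst) (hl : ∀ b, ∃ l, β b = l ++ [lst b])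
    {x x' : ℤ → A} {d d' : ℤ → ℤ} {q : ℤ → C} (h : Rep β x d q) (h' : Rep β x' d' q)
    (hno : ∀ i j, d i ≠ d' j) : ¬ Aperiodic q := by
  choose I hI using mono_cover (h.mono hβ)
  choose J hJ using mono_cover (h'.mono hβ)
  let S : ℤ → (A × ℤ) × (A × ℤ) := fun t => ((x (I t), t - d (I t)), (x' (J t), t - d' (J t)))
  have hfin : (Set.range S).Finite := by
    apply Set.Finite.subset (s := ((Set.univ : Set A) ×ˢ Set.Icc (0 : ℤ) (totalLen β)) ×ˢ
      ((Set.univ : Set A) ×ˢ Set.Icc (0 : ℤ) (totalLen β)))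
    · exact ((Set.finite_univ.prod (Set.finite_Icc _ _)).prod
        (Set.finite_univ.prod (Set.finite_Icc _ _)))
    · rintro _ ⟨t, rfl⟩
      exact ⟨⟨trivial, half_bound h I hI t⟩, ⟨trivial, half_bound h' J hJ t⟩⟩
  obtain ⟨p, hp, hper⟩ := periodic_of_det S hfin (by
    intro t t' he
    simp only [S, Prod.mk.injEq] at he
    obtain ⟨⟨h1, h2⟩, ⟨h3, h4⟩⟩ := he
    have hq : q (t - 1) = q (t' - 1) := by
      by_cases h0 : 0 < t - d (I t)
      · have := half_step hβ lst hinj hl h I hI h1 h2 (Or.inl h0)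
        exact half_val h I hI this.1 this.2
      · have h0' : 0 < t - d' (J t) := by
          have := hno (I t) (J t)
          have := hI t
          have := hJ t
          omega
        have := half_step hβ lst hinj hl h' J hJ h3 h4 (Or.inl h0')
        exact half_val h' J hJ this.1 this.2
    have r1 := half_step hβ lst hinj hl h I hI h1 h2 (Or.inr hq)
    have r2 := half_step hβ lst hinj hl h' J hJ h3 h4 (Or.inr hq)
    simp only [S, Prod.mk.injEq]
    exact ⟨r1, r2⟩)
  intro hap
  apply hap p hp
  funext t
  have := hper t
  simp only [S, Prod.mk.injEq] at this
  exact half_val h I hI this.1.1 this.1.2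

lemma Rep.aper {B C : Type*} {α : C → List B} (hα : NonErasing α) {q : ℤ → C} {e : ℤ → ℤ}
    {y : ℤ → B} (h : Rep α q e y) (hy : Aperiodic y) : Aperiodic q := by
  intro p hp hq
  set K := e p - e 0 with hK
  have hKpos : 0 < K := by
    have := h.mono hα (show (0 : ℤ) < p by omega)
    omega
  have h1 := (h.shiftX p).shiftY (-K)
  rw [hq] at h1
  have hc : (fun i => e (i + p) + -K) = e := by
    funext i
    exact cuts_unique (c := fun i => e (i + p) + -K) (fun i => ((α (q i)).length : ℤ)) h1.cut h.cut 0 (by simp [hK]) i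
  rw [hc] at h1
  have := h1.unique hα h
  apply hy K.toNat (by omega)
  funext t
  have h2 := congrFun this t
  simp only [sub_neg_eq_add] at h2
  rw [← h2]; congr 1; omega

/-- An elementary morphism is recognizable for aperiodic points. -/
lemma Elem.rec {A B : Type*} [Fintype A] {σ : A → List B} (hE : Elem σ) (hσ : NonErasing σ)
    {x x' : ℤ → A} {c c' : ℤ → ℤ} {y : ℤ → B} (hy : Aperiodic y) (h : Rep σ x c y)
    (h' : Rep σ x' c' y) (i0 : ℤ) : ∃ i', c i0 = c' i' := by
  classical
  by_contra! hno
  obtain ⟨i1, hi1, hi2⟩ := mono_cover (h'.mono hσ) (c i0)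
  have hi1' : c' i1 < c i0 := lt_of_le_of_ne hi1 (hno i1).symm
  set a := x' i1 with ha
  obtain ⟨r, hr⟩ : ∃ r : ℕ, c i0 = c' i1 + r := ⟨(c i0 - c' i1).toNat, by omega⟩
  have hcut := h'.cut i1
  rw [← ha] at hcut
  set u := (σ a).take r with hu
  set v := (σ a).drop r with hv
  have huv : σ a = u ++ v := (List.take_append_drop r _).symm
  have hul : u.length = r := by rw [hu, List.length_take]; omega
  have hvl : 0 < v.length := by rw [hv, List.length_drop]; omega
  have hlen : (σ a).length = r + v.length := by rw [huv, List.length_append, hul]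
  let τ : Option A → List B := fun o => o.elim v (fun b => if b = a then u else σ b)
  let ρ0 : A → List (Option A) := fun b => if b = a then [some a, none] else [some b]
  have hστ : comp τ ρ0 = σ := by
    funext b
    by_cases hb : b = a
    · simp [comp, τ, ρ0, hb, wordApply, huv]
    · simp [comp, τ, ρ0, hb, wordApply]
  have hτ : NonErasing τ := by
    rintro (_ | b)
    · exact List.length_pos_iff.1 hvl
    · by_cases hb : b = a
      · simp only [τ, Option.elim, hb, if_true]
        apply List.length_pos_iff.1; omega
      · simp only [τ, Option.elim, hb, if_false]
        exact hσ b
  have hρ0 : NonErasing ρ0 := by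
    intro b; simp only [ρ0]; split_ifs <;> simp
  -- the two finite words
  set N := totalLen τ with hN
  have w1 := (h.word i0 (N + 1)).2
  have w2 := (h'.word (i1 + 1) N).2
  have hv' : v = factor y (c i0) v.length := by
    have := (factor_split ((h'.eq i1).symm.trans huv)).2
    rw [hul, ← hr] at this
    exact this
  have hci : c' (i1 + 1) = c i0 + v.length := by rw [hcut, hlen, hr]; push_cast; ring
  have W2 : wordApply τ (none :: wordApply ρ0 (factor x' (i1 + 1) N)) =
      factor y (c i0) (v.length + (wordApply σ (factor x' (i1 + 1) N)).length) := by
    rw [factor_add, ← hci, ← w2, ← hv', wordApply, ← wa_comp, hστ]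
    rfl
  obtain ⟨tl, htl, htlen⟩ : ∃ tl, wordApply ρ0 (factor x i0 (N + 1)) = some (x i0) :: tl ∧
      N ≤ tl.length := by
    have hlen := wa_len ρ0 hρ0 (factor x (i0 + 1) N)
    rw [factor_length] at hlen
    rw [factor_cons]
    by_cases hb : x i0 = a
    · refine ⟨none :: wordApply ρ0 (factor x (i0 + 1) N), by simp [wordApply, ρ0, hb], ?_⟩
      simp; omega
    · exact ⟨wordApply ρ0 (factor x (i0 + 1) N), by simp [wordApply, ρ0, hb], hlen⟩
  have W1 : wordApply τ (some (x i0) :: tl) =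
      factor y (c i0) (wordApply σ (factor x i0 (N + 1))).length := by
    rw [← htl, ← wa_comp, hστ, ← w1]
  obtain ⟨ρ, τ1, e, f, hef, hτ1, hτρ, he, hlast⟩ := defect _ τ (some (x i0)) none tl
    (wordApply ρ0 (factor x' (i1 + 1) N)) hτ le_rfl (by simp) htlen
    (by have := wa_len ρ0 hρ0 (factor x' (i1 + 1) N); rwa [factor_length] at this)
    (by rw [W1, W2]; exact factor_comparable _ _ _ _)
  -- the factorization through the merged alphabet
  set κ := merge e f hef with hκ
  let α : {g : Option A // g ≠ f} → List B := fun g => τ1 g.1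
  let β : A → List {g : Option A // g ≠ f} := fun b => (wordApply ρ (ρ0 b)).map κ
  have hα : NonErasing α := fun g => hτ1 _
  have hακ : ∀ w, wordApply α (w.map κ) = wordApply τ1 w := by
    intro w
    rw [wa_map]
    congr 1
    funext g
    exact merge_val he g
  have hσαβ : σ = comp α β := by
    funext b
    simp only [comp, β, hακ]
    rw [← wa_comp, ← hτρ, ← hστ]; rfl
  have hβ : NonErasing β := by
    rw [hσαβ] at hσ; exact ne_right hσ
  have hcard : Fintype.card {g : Option A // g ≠ f} = Fintype.card A := by
    rw [merge_card]; simp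
  have hαE : Elem α := by
    intro m hm hF
    exact hE m (by omega) (by rw [hσαβ]; exact hF.of_left β)
  have hβE : Elem β := by
    intro m hm hF
    exact hE m hm (by rw [hσαβ]; exact hF.of_right hα)
  rw [hσαβ] at h h'
  obtain ⟨q, d, e0, r1, r2, r3⟩ := h.decomp hα hβ
  obtain ⟨q', d', e0', r1', r2', r3'⟩ := h'.decomp hα hβ
  set P := (ρ (some a)).map κ with hP
  have hβa : β a = P ++ (ρ none).map κ := by
    simp [β, ρ0, wordApply, hP]
  have hPf : P = factor q' (d' i1) P.length :=
    (factor_split ((r1'.eq i1).symm.trans hβa)).1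
  have hαP : (wordApply α P).length = r := by
    rw [hP, hακ]
    have : τ (some a) = wordApply τ1 (ρ (some a)) := by rw [hτρ]; rfl
    rw [← this]; simp [τ, hul]
  set J := d' i1 + P.length with hJ
  have hcommon : e0 (d i0) = e0' J := by
    rw [hJ, (r2'.word (d' i1) P.length).1, ← hPf, hαP, r3, r3', hr]
  have hall := hαE.both hα r2 r2' hcommon
  -- last letters
  let hat : A → Option A := fun b => if b = a then none else some b
  have hhat : ∀ b, hat b ≠ some a := by
    intro b; simp only [hat]; split_ifs with hb <;> simp [hb]
  have hhatinj : Function.Injective hat := by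
    intro b b' hbb
    simp only [hat] at hbb
    split_ifs at hbb with h1 h2 h2
    · rw [h1, h2]
    · exact Option.some.inj hbb
  have hβlast : ∀ b, ∃ l, β b = l ++ [κ (hat b)] := by
    intro b
    by_cases hb : b = a
    · obtain ⟨l, hl⟩ := hlast none
      exact ⟨P ++ l.map κ, by simp [hb, hβa, hl, hat]⟩
    · obtain ⟨l, hl⟩ := hlast (some b)
      exact ⟨l.map κ, by simp [β, ρ0, hb, hl, hat, wordApply]⟩
  have hkey : κ (hat (x (i0 - 1))) = κ (some a) := by
    have q1 : q (d i0 - 1) = κ (hat (x (i0 - 1))) := by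
      obtain ⟨l, hl⟩ := hβlast (x (i0 - 1))
      have := factor_last ((r1.eq (i0 - 1)).symm.trans hl)
      rw [← r1.cut, sub_add_cancel] at this
      exact this
    have q2 : q' (J - 1) = κ (some a) := by
      obtain ⟨l, hl⟩ := hlast (some a)
      have := factor_last (l := l.map κ) (g := κ (some a)) (hPf.symm.trans (by simp [hP, hl]))
      exact this
    rw [← q1, ← q2]
    exact (hall (-1)).1
  have hea : some a = e ∨ some a = f := by
    rcases merge_inj (hhat (x (i0 - 1))) hkey with h1 | h1
    · exact Or.inr h1.2
    · exact Or.inl h1.2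
  have hlinj : Function.Injective (fun b => κ (hat b)) := by
    intro b b' hbb
    by_contra hne
    have hne' : hat b ≠ hat b' := fun h => hne (hhatinj h)
    have e1 := hhat b
    have e2 := hhat b'
    rcases merge_inj hne' hbb with ⟨h1, h2⟩ | ⟨h1, h2⟩ <;> rcases hea with h3 | h3
    · exact e1 (h1.trans h3.symm)
    · exact e2 (h2.trans h3.symm)
    · exact e2 (h2.trans h3.symm)
    · exact e1 (h1.trans h3.symm)
  have s1 : Rep β x' (fun i => d' i + (d i0 - J)) q := by
    have := r1'.shiftY (d i0 - J)
    convert this using 1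
    funext t
    have := (hall (t - d i0)).1
    convert this using 2 <;> ring
  refine det_periodic hβ _ hlinj hβlast r1 s1 ?_ (r2.aper hα hy)
  intro i j hij
  have := (hβE.both hβ r1 s1 hij (i0 - i)).2
  rw [show i + (i0 - i) = i0 by ring] at this
  have hJ' : d' (j + (i0 - i)) = J := by omega
  apply hno (j + (i0 - i))
  rw [← r3, ← r3', hcommon, hJ']

end Recog

namespace Recog

lemma wa_heq {𝒜 : ℕ → Type*} {B : Type*} {m m' : ℕ} (h : m = m') (u : List (𝒜 m))
    (v : List (𝒜 m')) (huv : HEq u v) (f : 𝒜 m → List B) (g : 𝒜 m' → List B)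
    (hfg : ∀ a b, HEq a b → f a = g b) : wordApply f u = wordApply g v := by
  subst h
  have : f = g := funext fun a => hfg a a HEq.rfl
  rw [eq_of_heq huv, this]

lemma sigma_heq {𝒜 : ℕ → Type*} (σ : ∀ n, 𝒜 (n + 1) → List (𝒜 n)) {m m' : ℕ} (h : m = m')
    (a : 𝒜 (m + 1)) (b : 𝒜 (m' + 1)) (hab : HEq a b) : HEq (σ m a) (σ m' b) := by
  subst h
  rw [eq_of_heq hab]

lemma blockFrom_succ {𝒜 : ℕ → Type*} (σ : ∀ n, 𝒜 (n + 1) → List (𝒜 n)) (n k : ℕ) :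
    ∀ (a : 𝒜 (n + (k + 1))) (b : 𝒜 (n + 1 + k)), HEq a b →
    blockFrom σ n (k + 1) a = wordApply (σ n) (blockFrom σ (n + 1) k b) := by
  induction k with
  | zero =>
    intro a b hab
    have : a = b := eq_of_heq hab
    subst this
    show wordApply (fun a => [a]) (σ n a) = wordApply (σ n) [a]
    rw [wa_single (fun a => a)]; simp [wordApply]
  | succ k ih =>
    intro a b hab
    show wordApply (blockFrom σ n (k + 1)) (σ (n + (k + 1)) a) =
      wordApply (σ n) (wordApply (blockFrom σ (n + 1) k) (σ (n + 1 + k) b))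
    rw [← wa_comp]
    have e : n + (k + 1) = n + 1 + k := by omega
    exact wa_heq e _ _ (sigma_heq σ e a b hab) _ _ ih

lemma factor_infix {A : Type*} (x : ℤ → A) (i j : ℤ) (m n : ℕ) (h1 : i ≤ j)
    (h2 : j + m ≤ i + n) : factor x j m <:+: factor x i n := by
  obtain ⟨p, rfl⟩ : ∃ p : ℕ, j = i + p := ⟨(j - i).toNat, by omega⟩
  obtain ⟨r, rfl⟩ : ∃ r : ℕ, n = p + m + r := ⟨n - (p + m), by omega⟩
  rw [factor_add, factor_add]
  exact ⟨_, _, rfl⟩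

lemma len_le_total {A B : Type*} [Fintype A] (σ : A → List B) (a : A) :
    (σ a).length ≤ totalLen σ := by
  unfold totalLen
  exact Finset.single_le_sum (f := fun a => (σ a).length) (fun _ _ => Nat.zero_le _)
      (Finset.mem_univ _)

lemma Rep.cut_le {A B : Type*} [Fintype A] {σ : A → List B} {x : ℤ → A} {c : ℤ → ℤ} {y : ℤ → B}
    (h : Rep σ x c y) (i : ℤ) (n : ℕ) : c (i + n) ≤ c i + n * totalLen σ := by
  induction n with
  | zero => simp
  | succ n ih =>
    have h1 := h.cut (i + n)
    have h2 := len_le_total σ (x (i + n))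
    push_cast
    rw [← add_assoc, h1, add_mul]
    omega

lemma approx {𝒜 : ℕ → Type*} [∀ n, Fintype (𝒜 n)]
    (σ : ∀ n, 𝒜 (n + 1) → List (𝒜 n)) (hσ : ∀ n, NonErasing (σ n)) (n : ℕ) (x : ℤ → 𝒜 n)
    (hx : x ∈ sadicX σ n) (l : ℕ) (hl : totalLen (σ n) ≤ l) :
    ∃ (z : ℤ → 𝒜 (n + 1)) (c : ℤ → ℤ) (Y : ℤ → 𝒜 n), Rep (σ n) z c Y ∧ c 0 ≤ 0 ∧ 0 < c 1 ∧
      (∀ t : ℤ, |t| ≤ l → Y t = x t) ∧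
      (∀ (i : ℤ) (m : ℕ), -(l : ℤ) < c i → c (i + m) < l → factor z i m ∈ sadicLang σ (n + 1)) := by
  obtain ⟨k, a, hk, hin⟩ := hx (factor x (-l) (2 * l + 1)) ⟨_, _, rfl⟩
  obtain ⟨k, rfl⟩ : ∃ k', k = k' + 1 := ⟨k - 1, by omega⟩
  obtain ⟨b, hab⟩ : ∃ b : 𝒜 (n + 1 + k), HEq a b := by
    have e : n + (k + 1) = n + 1 + k := by omega
    exact ⟨cast (by rw [e]) a, (cast_heq _ _).symm⟩
  rw [blockFrom_succ σ n k a b hab] at hin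
  have hlen := hin.length_le
  rw [factor_length] at hlen
  have hk1 : 1 ≤ k := by
    by_contra hcon
    have : k = 0 := by omega
    subst this
    have e : wordApply (σ n) (blockFrom σ (n + 1) 0 b) = σ n b := by
      show wordApply (σ n) [b] = _
      simp [wordApply]
    rw [e] at hlen
    have := len_le_total (σ n) b
    omega
  have hw : ∀ u, u <:+: blockFrom σ (n + 1) k b → u ∈ sadicLang σ (n + 1) :=
    fun u hu => ⟨k, b, hk1, hu⟩
  generalize blockFrom σ (n + 1) k b = w at hin hw hlen
  obtain ⟨b0, hb0⟩ : ∃ b0, b0 ∈ w := by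
    apply List.exists_mem_of_ne_nil
    rintro rfl
    simp [wordApply] at hlen
  let z0 : ℤ → 𝒜 (n + 1) := fun i => w.getD i.toNat b0
  have hz0 : factor z0 0 w.length = w := by
    rw [factor_def]
    apply List.ext_getElem
    · simp
    · intro j h1 h2
      simp [z0, h2]
  obtain ⟨c0, Y0, hR, hc0⟩ := exists_rep (σ n) (hσ n) z0 0
  obtain ⟨s, t, hst⟩ := hin
  have hW := hR.word 0 w.length
  rw [hz0, hc0, zero_add, zero_add] at hW
  have hWl : (wordApply (σ n) w).length = s.length + (2 * l + 1) + t.length := by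
    rw [← hst]; simp [factor_length]; omega
  have hf : factor x (-l) (2 * l + 1) = factor Y0 s.length (2 * l + 1) := by
    have h1 := (factor_split (hW.2.symm.trans hst.symm)).1
    have h2 := (factor_split h1.symm).2
    rw [factor_length, zero_add] at h2
    exact h2
  have hm := hR.mono (hσ n)
  obtain ⟨i0, hi0, hi1⟩ := mono_cover hm (s.length + l)
  have hR' := (hR.shiftX i0).shiftY (-(s.length + l))
  refine ⟨_, _, _, hR', ?_, ?_, ?_, ?_⟩
  · simp; omega
  · rw [add_comm 1 i0]; omega
  · intro t ht
    rw [abs_le] at ht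
    have := factor_inj hf (t + l).toNat (by omega)
    rw [show ((t + l).toNat : ℤ) = t + l by omega] at this
    rw [show -(l : ℤ) + (t + l) = t by ring] at this
    rw [this]
    congr 1; ring
  · intro i m h1 h2
    have e : factor (fun i => z0 (i + i0)) i m = factor z0 (i + i0) m := by
      apply factor_congr; intro j _; congr 1; ring
    rw [e]
    apply hw
    rw [← hz0]
    have a1 : 0 < i + i0 := by
      apply hm.lt_iff_lt.1
      rw [hc0]; omega
    have a2 : i + m + i0 < w.length := by
      apply hm.lt_iff_lt.1
      rw [hW.1, hWl]; push_cast; omega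
    exact factor_infix _ _ _ _ _ (by omega) (by omega)

lemma ulim {T : Type*} (f : ℕ → T) (S : Set T) (hS : S.Finite) (hf : ∀ l, f l ∈ S) :
    ∃ g, ∀ᶠ l in (Filter.hyperfilter ℕ : Filter ℕ), f l = g := by
  have := (Ultrafilter.finite_biUnion_mem_iff (f := Filter.hyperfilter ℕ) hS
    (s := fun g => {l | f l = g})).1 (by
      have e : (⋃ i ∈ S, {l | f l = i}) = Set.univ := by
        ext l; simpa using hf l
      rw [e]; exact Filter.univ_mem)
  obtain ⟨g, _, hg⟩ := this
  exact ⟨g, hg⟩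

lemma desub {𝒜 : ℕ → Type*} [∀ n, Fintype (𝒜 n)]
    (σ : ∀ n, 𝒜 (n + 1) → List (𝒜 n)) (hσ : ∀ n, NonErasing (σ n)) (n : ℕ) (x : ℤ → 𝒜 n)
    (hx : x ∈ sadicX σ n) : ∃ z ∈ sadicX σ (n + 1), ∃ c, Rep (σ n) z c x := by
  set L := totalLen (σ n) with hL
  choose z c Y hR h0 h1 hY hlang using fun l : ℕ => approx σ hσ n x hx (l + L) (by omega)
  have hz : ∀ i, ∃ g, ∀ᶠ l in (Filter.hyperfilter ℕ : Filter ℕ), z l i = g := fun i =>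
    ulim _ Set.univ Set.finite_univ (fun _ => trivial)
  have hc : ∀ i, ∃ g, ∀ᶠ l in (Filter.hyperfilter ℕ : Filter ℕ), c l i = g := by
    intro i
    apply ulim _ (Set.Icc (-((i.natAbs + 1 : ℕ) * L : ℤ)) ((i.natAbs + 1 : ℕ) * L))
      (Set.finite_Icc _ _)
    intro l
    have hm := (hR l).mono (hσ n)
    have a1 := (hR l).cut_le 0 1
    have a2 := h0 l
    have a3 := h1 l
    rw [← hL] at a1
    simp only [zero_add, Nat.cast_one, one_mul] at a1
    rcases le_total 0 i with hi | hi
    · have b := (hR l).cut_le 0 i.natAbs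
      rw [zero_add, ← hL, show ((i.natAbs : ℕ) : ℤ) = i by omega] at b
      have b2 := hm.monotone hi
      have b3 : 0 ≤ i * L := by positivity
      rw [Set.mem_Icc]; push_cast
      rw [show |i| = i from abs_of_nonneg hi, add_mul]
      constructor <;> linarith
    · have b := (hR l).cut_le i i.natAbs
      rw [← hL, show i + ((i.natAbs : ℕ) : ℤ) = 0 by omega,
        show ((i.natAbs : ℕ) : ℤ) = -i by omega] at b
      have b2 := hm.monotone hi
      have b3 : 0 ≤ (-i) * L := mul_nonneg (by omega) (by positivity)
      rw [Set.mem_Icc]; push_cast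
      rw [show |i| = -i from abs_of_nonpos hi, add_mul]
      constructor <;> linarith
  choose Z hZ using hz
  choose D hD using hc
  have hlarge : ∀ K : ℕ, ∀ᶠ l in (Filter.hyperfilter ℕ : Filter ℕ), K ≤ l := fun K =>
    Filter.Eventually.filter_mono Nat.hyperfilter_le_atTop (Filter.eventually_ge_atTop K)
  refine ⟨Z, ?_, D, ?_, ?_⟩
  · rintro w ⟨i, m, rfl⟩
    have hall : ∀ᶠ l in (Filter.hyperfilter ℕ : Filter ℕ), ∀ j ∈ Finset.range m,
        z l (i + j) = Z (i + j) := by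
      rw [Filter.eventually_all_finset]
      intro j _
      exact hZ _
    obtain ⟨l, a1, a2, a3, a4⟩ := (hall.and ((hD i).and ((hD (i + m)).and
      (hlarge ((D i).natAbs + (D (i + m)).natAbs + 1))))).exists
    have := hlang l i m (by rw [a2]; push_cast; omega) (by rw [a3]; push_cast; omega)
    convert this using 1
    apply factor_congr
    intro j hj
    exact (a1 j (Finset.mem_range.2 hj)).symm
  · intro i
    obtain ⟨l, a1, a2, a3⟩ := ((hZ i).and ((hD i).and (hD (i + 1)))).exists
    rw [← a1, ← a2, ← a3]
    exact (hR l).cut i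
  · intro i
    obtain ⟨l, a1, a2, a3⟩ := ((hZ i).and ((hD i).and
      (hlarge ((D i).natAbs + (σ n (Z i)).length)))).exists
    have := (hR l).eq i
    rw [a1, a2] at this
    refine this.trans (factor_congr ?_)
    intro j hj
    apply hY
    rw [abs_le]; push_cast
    constructor <;> omega

/-- all points of level `n` are represented by a morphism from `m` letters. -/
def Good {𝒜 : ℕ → Type*} (σ : ∀ n, 𝒜 (n + 1) → List (𝒜 n)) (n m : ℕ) : Prop :=
  ∃ α : Fin m → List (𝒜 n), NonErasing α ∧ ∀ x ∈ sadicX σ n, ∃ q c, Rep α q c x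

lemma good_step {𝒜 : ℕ → Type*} [∀ n, Fintype (𝒜 n)]
    (σ : ∀ n, 𝒜 (n + 1) → List (𝒜 n)) (hσ : ∀ n, NonErasing (σ n)) (n m : ℕ)
    (h : Good σ (n + 1) m) : Good σ n m := by
  obtain ⟨α, hα, h⟩ := h
  refine ⟨comp (σ n) α, comp_ne (hσ n) hα, fun x hx => ?_⟩
  obtain ⟨z, hz, c, hc⟩ := desub σ hσ n x hx
  obtain ⟨q, d, hq⟩ := h z hz
  exact ⟨q, _, hq.comp hc⟩

lemma good_base {𝒜 : ℕ → Type*} [∀ n, Fintype (𝒜 n)]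
    (σ : ∀ n, 𝒜 (n + 1) → List (𝒜 n)) (n : ℕ) : Good σ n (Fintype.card (𝒜 n)) := by
  let E := Fintype.equivFin (𝒜 n)
  refine ⟨fun i => [E.symm i], fun i => by simp, fun x _ => ⟨fun i => E (x i), id, ?_, ?_⟩⟩
  · intro i; simp
  · intro i; simp [factor_one]

lemma rep_of_centered {A B : Type*} {σ : A → List B} {y : ℤ → B} {k : ℤ} {x : ℤ → A}
    (h : IsCenteredRep σ y k x) :
    Rep σ x (fun i => cut σ x i - k) y ∧ cut σ x 0 - k ≤ 0 ∧ 0 < cut σ x 1 - k := by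
  obtain ⟨h1, h2, h3⟩ := h
  have c0 : cut σ x 0 = 0 := by simp [cut]
  have c1 := cut_succ' σ x 0
  rw [c0] at c1
  refine ⟨⟨fun i => by rw [cut_succ']; ring, fun i => ?_⟩, by omega, by
    simp only [zero_add] at c1; omega⟩
  rw [factor_def]
  apply List.ext_getElem
  · simp
  · intro j hj _
    have : y (cut σ x i + j - k) = (σ (x i)).get ⟨j, hj⟩ := h1 i j hj
    simp only [List.getElem_map, List.getElem_range]
    rw [List.get_eq_getElem] at this
    rw [← this, show cut σ x i - k + (j : ℤ) = cut σ x i + j - k by ring]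

lemma good_drop {𝒜 : ℕ → Type*} [∀ n, Fintype (𝒜 n)]
    (σ : ∀ n, 𝒜 (n + 1) → List (𝒜 n)) (hσ : ∀ n, NonErasing (σ n)) (n m : ℕ)
    (h : Good σ (n + 1) m) (hrec : ¬ RecInAp (σ n) (sadicX σ (n + 1))) :
    ∃ m', m' < m ∧ Good σ n m' := by
  obtain ⟨α, hα, h⟩ := h
  have hS := comp_ne (hσ n) hα
  by_cases hE : Elem (comp (σ n) α)
  · exfalso
    apply hrec
    intro y hy k k' x x' hx hx' hr hr'
    obtain ⟨r1, r2, r3⟩ := rep_of_centered hr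
    obtain ⟨r1', r2', r3'⟩ := rep_of_centered hr'
    obtain ⟨q, e, he⟩ := h x hx
    obtain ⟨q', e', he'⟩ := h x' hx'
    have R := he.comp r1
    have R' := he'.comp r1'
    obtain ⟨i', hi'⟩ := hE.rec hS hy R R' 0
    have hall := hE.both hS R R' hi'
    set D := e' i' - e 0 with hD
    -- x' shifted by D is x
    have hqq : (fun i => q' (i + i')) = q := by
      funext i
      have := (hall i).1
      rw [zero_add] at this
      rw [this, add_comm]
    have s1 := (he'.shiftX i').shiftY (-D)
    rw [hqq] at s1
    have hee : (fun i => e' (i + i') + -D) = e := by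
      funext i
      exact cuts_unique (c := fun i => e' (i + i') + -D) (fun i => ((α (q i)).length : ℤ))
        s1.cut he.cut 0 (by simp [hD]) i
    rw [hee] at s1
    have hxx := s1.unique hα he
    have hxx' : (fun t => x' (t + D)) = x := by
      rw [← hxx]; funext t; rw [sub_neg_eq_add]
    have s2 := r1'.shiftX D
    rw [hxx'] at s2
    have hcc : ∀ i, cut (σ n) x' (i + D) - k' = cut (σ n) x i - k := by
      intro i
      refine cuts_unique (c := fun i => cut (σ n) x' (i + D) - k')
        (c' := fun i => cut (σ n) x i - k) (fun i => ((σ n (x i)).length : ℤ))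
        s2.cut r1.cut (e 0) ?_ i
      have : e 0 + D = e' i' := by omega
      simp only [this]
      exact hi'.symm
    have hD0 : D = 0 := by
      apply cover_unique (r1'.mono (hσ n)) (t := 0) (i := D) (j := 0)
      · have a := hcc 0
        have b := hcc 1
        rw [zero_add] at a
        rw [add_comm (1 : ℤ) D] at b
        constructor <;> omega
      · exact ⟨r2', by simpa using r3'⟩
    have hxe : x = x' := by rw [← hxx', hD0]; simp
    refine ⟨?_, hxe⟩
    have := hcc 0
    rw [hD0, hxe] at this
    simp only [add_zero] at this
    omega
  · unfold Elem at hE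
    push Not at hE
    obtain ⟨m', hm', β', α', hα', heq⟩ := hE
    rw [Fintype.card_fin] at hm'
    refine ⟨m', hm', α', hα', fun x hx => ?_⟩
    obtain ⟨z, hz, c, hc⟩ := desub σ hσ n x hx
    obtain ⟨q, d, hq⟩ := h z hz
    have R := hq.comp hc
    rw [heq] at R hS
    obtain ⟨q2, _, e2, _, h2, _⟩ := R.decomp hα' (ne_right hS)
    exact ⟨q2, e2, h2⟩

end Recog

open Recog in
/-- A directive sequence with `liminf |𝒜_n| < ∞` and a uniformly bounded number
of languages of points of the `X^(n)_σ` is eventually recognizable for aperiodic points. -/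
theorem stmt2 {𝒜 : ℕ → Type*} [∀ n, Fintype (𝒜 n)]
    (σ : ∀ n, 𝒜 (n + 1) → List (𝒜 n)) (hσ : ∀ n, NonErasing (σ n))
    (hliminf : Filter.liminf (fun n => (Fintype.card (𝒜 n) : ℕ∞)) Filter.atTop < ⊤)
    (hlang : ∃ L : ℕ, ∀ n : ℕ,
      {ℒ : Set (List (𝒜 n)) | ∃ x ∈ sadicX σ n, ℒ = lang x}.Finite ∧
      {ℒ : Set (List (𝒜 n)) | ∃ x ∈ sadicX σ n, ℒ = lang x}.ncard ≤ L) :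
    ∃ n₀ : ℕ, ∀ n ≥ n₀, RecInAp (σ n) (sadicX σ (n + 1)) := by
  classical
  obtain ⟨K, hK⟩ : ∃ K : ℕ, ∃ᶠ n in Filter.atTop, Fintype.card (𝒜 n) ≤ K := by
    obtain ⟨K, hK⟩ := ENat.ne_top_iff_exists.1 hliminf.ne
    refine ⟨K, ?_⟩
    have : Filter.liminf (fun n => (Fintype.card (𝒜 n) : ℕ∞)) Filter.atTop < ((K + 1 : ℕ) : ℕ∞) := by
      rw [← hK]; exact_mod_cast Nat.lt_succ_self K
    refine (Filter.frequently_lt_of_liminf_lt (by isBoundedDefault) this).mono ?_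
    intro n hn
    have : Fintype.card (𝒜 n) < K + 1 := by exact_mod_cast hn
    omega
  have hdown : ∀ m n k : ℕ, Good σ (n + k) m → Good σ n m := by
    intro m n k
    induction k with
    | zero => exact id
    | succ k ih => exact fun h => ih (good_step σ hσ (n + k) m h)
  have hgood : ∀ n, ∃ m, m ≤ K ∧ Good σ n m := by
    intro n
    obtain ⟨N, hN, hc⟩ := (Filter.frequently_atTop.1 hK) n
    obtain ⟨k, rfl⟩ := Nat.exists_eq_add_of_le hN
    exact ⟨_, hc, hdown _ n k (good_base σ (n + k))⟩
  have hex : ∀ n, ∃ m, Good σ n m := fun n => (hgood n).imp fun _ h => h.2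
  let g : ℕ → ℕ := fun n => Nat.find (hex n)
  have hg : ∀ n, Good σ n (g n) := fun n => Nat.find_spec (hex n)
  have hmin : ∀ n m, Good σ n m → g n ≤ m := fun n m h => Nat.find_min' (hex n) h
  have hmono : Monotone g := monotone_nat_of_le_succ fun n =>
    hmin n _ (good_step σ hσ n _ (hg (n + 1)))
  have hbd : BddAbove (Set.range g) := by
    refine ⟨K, ?_⟩
    rintro _ ⟨n, rfl⟩
    obtain ⟨m, h1, h2⟩ := hgood n
    exact (hmin n m h2).trans h1
  obtain ⟨n₀, hn₀⟩ := Nat.sSup_mem (Set.range_nonempty g) hbd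
  refine ⟨n₀, fun n hn => ?_⟩
  by_contra hrec
  obtain ⟨m', h1, h2⟩ := good_drop σ hσ n _ (hg (n + 1)) hrec
  have h3 := hmin n m' h2
  have h4 : g (n + 1) ≤ g n₀ := by rw [hn₀]; exact le_csSup hbd ⟨_, rfl⟩
  have h5 := hmono hn
  omega
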